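/- arXiv:2106.05610 — 4 statements merged into one kernel-verified Lean document; each statement's English description precedes it below -/
import Mathlib

section
/- Let G be a finite simple graph with m ≥ 1 edges on a vertex set V with |V| = n. For a set C ⊆ V let ∂(C) denote the number of edges of G having exactly one endpoint in C. Consider any sequence of partitions P₀, P₁, …, P_{n−1} of V in which P₀ is the partition into singletons and, for each i, P_{i+1} is obtained from P_i by replacing two distinct blocks U_i and V_i of P_i by their union. Then the total merge cost satisfies ∑_{i=0}^{n−2} min(∂(U_i), ∂(V_i)) ≤ 2m · log₂(2m). -/
open Finset

/-- The number of edges of `G` with exactly one endpoint in `C`. -/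
def boundaryDeg {α : Type*} [Fintype α] [DecidableEq α]
    (G : SimpleGraph α) [DecidableRel G.Adj] (C : Finset α) : ℕ :=
  (G.edgeFinset.filter (fun e => ∃ a b : α, e = s(a, b) ∧ a ∈ C ∧ b ∉ C)).card

/-- The number of edges with exactly one endpoint in `C` is at most the sum of the degrees
in `C`. -/
theorem boundaryDeg_le_sum_degree {α : Type*} [Fintype α] [DecidableEq α]
    (G : SimpleGraph α) [DecidableRel G.Adj] (C : Finset α) :
    boundaryDeg G C ≤ ∑ v ∈ C, G.degree v := by
  have hsub : G.edgeFinset.filter (fun e => ∃ a b : α, e = s(a, b) ∧ a ∈ C ∧ b ∉ C) ⊆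
      C.biUnion (fun v => G.incidenceFinset v) := by
    intro e he
    obtain ⟨he, a, b, rfl, ha, -⟩ := mem_filter.1 he
    refine mem_biUnion.2 ⟨a, ha, ?_⟩
    rw [SimpleGraph.mem_incidenceFinset]
    exact ⟨SimpleGraph.mem_edgeFinset.1 he, Sym2.mem_mk_left a b⟩
  calc boundaryDeg G C ≤ (C.biUnion (fun v => G.incidenceFinset v)).card := card_le_card hsub
    _ ≤ ∑ v ∈ C, (G.incidenceFinset v).card := card_biUnion_le
    _ = ∑ v ∈ C, G.degree v := by simp

theorem mul_logb_add_mul_logb_add_le {x y : ℝ} (hx : 0 ≤ x) (hxy : x ≤ y) :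
    x * Real.logb 2 x + y * Real.logb 2 y + x ≤ (x + y) * Real.logb 2 (x + y) := by
  rcases hx.eq_or_lt with rfl | hx
  · simp
  have h₁ : 1 + Real.logb 2 x ≤ Real.logb 2 (x + y) := by
    have h : Real.logb 2 (2 * x) = 1 + Real.logb 2 x := by
      rw [Real.logb_mul (by norm_num) hx.ne', Real.logb_self_eq_one (by norm_num)]
    rw [← h]
    exact Real.logb_le_logb_of_le (by norm_num) (by linarith) (by linarith)
  have h₂ : Real.logb 2 y ≤ Real.logb 2 (x + y) :=
    Real.logb_le_logb_of_le (by norm_num) (by linarith) (by linarith)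
  nlinarith [mul_le_mul_of_nonneg_left h₁ hx.le,
    mul_le_mul_of_nonneg_left h₂ (hx.le.trans hxy)]

/-- The function `x ↦ x log₂ x` gains at least `min x y` when `x` and `y` are added. -/
theorem mul_logb_add_mul_logb_add_min_le {x y : ℝ} (hx : 0 ≤ x) (hy : 0 ≤ y) :
    x * Real.logb 2 x + y * Real.logb 2 y + min x y ≤ (x + y) * Real.logb 2 (x + y) := by
  rcases le_total x y with h | h
  · rw [min_eq_left h]
    exact mul_logb_add_mul_logb_add_le hx h
  · rw [min_eq_right h, add_comm x y, add_comm (x * _)]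
    exact mul_logb_add_mul_logb_add_le hy h

theorem nat_mul_logb_nonneg (k : ℕ) : 0 ≤ (k : ℝ) * Real.logb 2 k := by
  rcases Nat.eq_zero_or_pos k with rfl | hk
  · simp
  · exact mul_nonneg k.cast_nonneg
      (Real.logb_nonneg (by norm_num) (by exact_mod_cast hk))

theorem nat_mul_logb_le {k l : ℕ} (h : k ≤ l) :
    (k : ℝ) * Real.logb 2 k ≤ k * Real.logb 2 l := by
  rcases Nat.eq_zero_or_pos k with rfl | hk
  · simp
  · exact mul_le_mul_of_nonneg_left
      (Real.logb_le_logb_of_le (by norm_num) (by exact_mod_cast hk) (by exact_mod_cast h))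
      k.cast_nonneg

/-- Merging two distinct blocks of a family of disjoint nonempty sets replaces two summands
by one. -/
theorem sum_insert_union_erase_erase {α M : Type*} [DecidableEq α] [AddCommMonoid M]
    {P : Finset (Finset α)} {S T : Finset α} (hne : ∀ C ∈ P, C.Nonempty)
    (hdisj : (P : Set (Finset α)).PairwiseDisjoint id) (hS : S ∈ P) (hT : T ∈ P) (hST : S ≠ T)
    (f : Finset α → M) :
    f S + f T + ∑ C ∈ insert (S ∪ T) ((P.erase S).erase T), f C =
      f (S ∪ T) + ∑ C ∈ P, f C := by
  have hnot : S ∪ T ∉ (P.erase S).erase T := by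
    intro h
    obtain ⟨-, h⟩ := mem_erase.1 h
    obtain ⟨hU, h⟩ := mem_erase.1 h
    obtain ⟨x, hx⟩ := hne S hS
    exact disjoint_left.1 (hdisj h hS hU) (mem_union_left T hx) hx
  rw [sum_insert hnot, ← add_sum_erase P f hS,
    ← add_sum_erase (P.erase S) f (mem_erase.2 ⟨hST.symm, hT⟩)]
  abel

theorem pairwiseDisjoint_insert_union_erase_erase {α : Type*} [DecidableEq α]
    {P : Finset (Finset α)} {S T : Finset α}
    (hdisj : (P : Set (Finset α)).PairwiseDisjoint id) (hS : S ∈ P) (hT : T ∈ P) :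
    ((insert (S ∪ T) ((P.erase S).erase T) : Finset (Finset α)) :
      Set (Finset α)).PairwiseDisjoint id := by
  rw [coe_insert]
  refine Set.PairwiseDisjoint.insert (hdisj.subset ?_) ?_
  · exact coe_subset.2 ((erase_subset _ _).trans (erase_subset _ _))
  · intro C hC _
    obtain ⟨hCT, hC⟩ := mem_erase.1 (mem_coe.1 hC)
    obtain ⟨hCS, hC⟩ := mem_erase.1 hC
    exact disjoint_union_left.2 ⟨hdisj hS hC hCS.symm, hdisj hT hC hCT.symm⟩

/-- for any merge sequence of partitions of the vertex set starting from
singletons, the total merge cost `∑ min(∂(Uᵢ), ∂(Vᵢ))` is at most `2m · log₂(2m)`. -/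
theorem total_merge_cost_le {α : Type*} [Fintype α] [DecidableEq α]
    (G : SimpleGraph α) [DecidableRel G.Adj]
    (n m : ℕ) (hn : n = Fintype.card α) (hm : m = G.edgeFinset.card) (hm1 : 1 ≤ m)
    (P : ℕ → Finset (Finset α)) (U B : ℕ → Finset α)
    (hP0 : P 0 = Finset.univ.image (fun v => ({v} : Finset α)))
    (hstep : ∀ i < n - 1, U i ∈ P i ∧ B i ∈ P i ∧ U i ≠ B i ∧
      P (i + 1) = insert (U i ∪ B i) (((P i).erase (U i)).erase (B i))) :
    (∑ i ∈ Finset.range (n - 1),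
        (min (boundaryDeg G (U i)) (boundaryDeg G (B i)) : ℝ))
      ≤ 2 * m * Real.logb 2 (2 * m) := by
  set vol : Finset α → ℕ := fun C => ∑ v ∈ C, G.degree v with hvol
  set f : Finset α → ℝ := fun C => (vol C : ℝ) * Real.logb 2 (vol C) with hf
  have key : ∀ i ≤ n - 1, (∀ C ∈ P i, C.Nonempty) ∧
      (P i : Set (Finset α)).PairwiseDisjoint id ∧
      (∑ j ∈ Finset.range i,
        (min (boundaryDeg G (U j)) (boundaryDeg G (B j)) : ℝ)) ≤ ∑ C ∈ P i, f C := by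
    intro i
    induction i with
    | zero =>
      intro _
      refine ⟨?_, ?_, ?_⟩
      · intro C hC
        rw [hP0] at hC
        obtain ⟨v, -, rfl⟩ := mem_image.1 hC
        exact singleton_nonempty v
      · intro C hC D hD hCD
        rw [hP0] at hC hD
        obtain ⟨v, -, rfl⟩ := mem_image.1 (mem_coe.1 hC)
        obtain ⟨w, -, rfl⟩ := mem_image.1 (mem_coe.1 hD)
        exact disjoint_singleton.2 fun h => hCD (by rw [h])
      · rw [sum_range_zero]
        exact sum_nonneg fun C _ => nat_mul_logb_nonneg (vol C)
    | succ i ih =>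
      intro hi
      obtain ⟨hne, hdisj, hsum⟩ := ih (by omega)
      obtain ⟨hU, hB, hUB, hP⟩ := hstep i (by omega)
      have hmerge := sum_insert_union_erase_erase hne hdisj hU hB hUB f
      have hunion : vol (U i ∪ B i) = vol (U i) + vol (B i) :=
        sum_union (hdisj hU hB hUB)
      have hgain : f (U i) + f (B i) + min (vol (U i) : ℝ) (vol (B i)) ≤ f (U i ∪ B i) := by
        simp only [hf, hunion, Nat.cast_add]
        exact mul_logb_add_mul_logb_add_min_le (Nat.cast_nonneg _) (Nat.cast_nonneg _)
      have hcost : min (boundaryDeg G (U i) : ℝ) (boundaryDeg G (B i)) ≤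
          min (vol (U i) : ℝ) (vol (B i)) :=
        min_le_min (Nat.cast_le.2 (boundaryDeg_le_sum_degree G _))
          (Nat.cast_le.2 (boundaryDeg_le_sum_degree G _))
      rw [hP]
      refine ⟨?_, pairwiseDisjoint_insert_union_erase_erase hdisj hU hB, ?_⟩
      · intro C hC
        rcases mem_insert.1 hC with rfl | hC
        · exact (hne _ hU).mono subset_union_left
        · exact hne C (mem_of_mem_erase (mem_of_mem_erase hC))
      · rw [sum_range_succ]
        linarith
  obtain ⟨-, hdisj, hsum⟩ := key (n - 1) le_rfl
  have htotal : ∑ v, G.degree v = 2 * m := by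
    rw [hm]
    exact G.sum_degrees_eq_twice_card_edges
  have hle : ∀ C, vol C ≤ 2 * m := fun C =>
    htotal ▸ sum_le_sum_of_subset (subset_univ C)
  have hvolsum : ∑ C ∈ P (n - 1), vol C ≤ 2 * m := by
    rw [← htotal]
    calc ∑ C ∈ P (n - 1), vol C = ∑ v ∈ (P (n - 1)).biUnion id, G.degree v :=
          (sum_biUnion hdisj).symm
      _ ≤ ∑ v, G.degree v := sum_le_sum_of_subset (subset_univ _)
  calc _ ≤ ∑ C ∈ P (n - 1), f C := hsum
    _ ≤ ∑ C ∈ P (n - 1), (vol C : ℝ) * Real.logb 2 ((2 * m : ℕ) : ℝ) :=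
        sum_le_sum fun C _ => nat_mul_logb_le (hle C)
    _ = ((∑ C ∈ P (n - 1), vol C : ℕ) : ℝ) * Real.logb 2 ((2 * m : ℕ) : ℝ) := by
        rw [← sum_mul, Nat.cast_sum]
    _ ≤ ((2 * m : ℕ) : ℝ) * Real.logb 2 ((2 * m : ℕ) : ℝ) :=
        mul_le_mul_of_nonneg_right (Nat.cast_le.2 hvolsum)
          (Real.logb_nonneg (by norm_num) (Nat.one_le_cast.2 (by omega)))
    _ = 2 * m * Real.logb 2 (2 * m) := by push_cast; ring
end

section
/- For every finite binary tree whose leaves are labeled by positive natural numbers and whose total leaf weight is W, the sum, over all internal nodes v of the tree, of min(weight of the left subtree of v, weight of the right subtree of v) is at most W · log₂ W, where the weight of a subtree is the sum of the labels of its leaves. -/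
/-- A finite binary tree whose leaves carry positive natural-number labels. -/
inductive BTree where
  | leaf : ℕ+ → BTree
  | node : BTree → BTree → BTree

/-- The weight of a tree: the sum of its leaf labels. -/
def BTree.weight : BTree → ℕ
  | .leaf w => w
  | .node l r => l.weight + r.weight

/-- The sum, over all internal nodes, of the minimum of the weights of the two subtrees. -/
def BTree.cost : BTree → ℕ
  | .leaf _ => 0
  | .node l r => min l.weight r.weight + l.cost + r.cost

theorem BTree.weight_pos (t : BTree) : 0 < t.weight := by
  induction t with
  | leaf w => exact w.pos
  | node l r hl hr => exact Nat.add_pos_left hl _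

theorem add_mul_logb_two_le_of_le {a b : ℝ} (ha : 0 < a) (hab : a ≤ b) :
    a + a * Real.logb 2 a + b * Real.logb 2 b ≤ (a + b) * Real.logb 2 (a + b) := by
  have hb : 0 < b := ha.trans_le hab
  have h₁ : 1 + Real.logb 2 a ≤ Real.logb 2 (a + b) := by
    rw [← Real.logb_self_eq_one one_lt_two, ← Real.logb_mul two_ne_zero ha.ne']
    exact Real.logb_le_logb_of_le one_lt_two (by positivity) (by linarith)
  have h₂ : Real.logb 2 b ≤ Real.logb 2 (a + b) :=
    Real.logb_le_logb_of_le one_lt_two hb (by linarith)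
  linarith [mul_le_mul_of_nonneg_left h₁ ha.le, mul_le_mul_of_nonneg_left h₂ hb.le]

theorem min_add_mul_logb_two_le {a b : ℝ} (ha : 0 < a) (hb : 0 < b) :
    min a b + a * Real.logb 2 a + b * Real.logb 2 b ≤ (a + b) * Real.logb 2 (a + b) := by
  rcases le_total a b with h | h
  · rw [min_eq_left h]
    exact add_mul_logb_two_le_of_le ha h
  · rw [min_eq_right h, add_comm a b]
    linarith [add_mul_logb_two_le_of_le hb h]

/-- the total cost is at most `W · log₂ W` where `W` is the total weight. -/
theorem btree_cost_le (t : BTree) :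
    (t.cost : ℝ) ≤ (t.weight : ℝ) * Real.logb 2 (t.weight : ℝ) := by
  induction t with
  | leaf w =>
    have hw : (1 : ℝ) ≤ ((BTree.leaf w).weight : ℝ) := by
      exact_mod_cast (BTree.leaf w).weight_pos
    rw [BTree.cost, Nat.cast_zero]
    exact mul_nonneg (by positivity) (Real.logb_nonneg one_lt_two hw)
  | node l r hl hr =>
    simp only [BTree.cost, BTree.weight, Nat.cast_add, Nat.cast_min]
    linarith [min_add_mul_logb_two_le (Nat.cast_pos.mpr l.weight_pos)
      (Nat.cast_pos.mpr r.weight_pos)]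
end

section
/- Let T be a finite binary tree whose leaves are labeled by positive natural numbers, with total leaf weight W, and let ℓ be a leaf of T with label wℓ. Then the number of internal nodes v on the path from ℓ to the root of T for which the subtree of v containing ℓ has weight at most the weight of the sibling subtree of v is at most log₂(W / wℓ). -/
/-- The subtree of `t` found by following the list of directions `p`
(`true` = left child, `false` = right child), if it exists. -/
def BTree.subtreeAt : BTree → List Bool → Option BTree
  | t, [] => some t
  | .leaf _, _ :: _ => none
  | .node l r, b :: p => (if b then l else r).subtreeAt p

/-- The number of internal nodes along the path `p` at which the subtree containing the
endpoint of the path has weight at most the weight of the sibling subtree. -/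
def BTree.lightCount : BTree → List Bool → ℕ
  | _, [] => 0
  | .leaf _, _ :: _ => 0
  | .node l r, b :: p =>
      (if (if b then l else r).weight ≤ (if b then r else l).weight then 1 else 0)
        + (if b then l else r).lightCount p

/-- Each light step at least doubles the weight on the way up from a subtree `s` of `t`. -/
theorem BTree.two_pow_lightCount_mul_weight_le {t s : BTree} {p : List Bool}
    (h : t.subtreeAt p = some s) : 2 ^ t.lightCount p * s.weight ≤ t.weight := by
  induction p generalizing t with
  | nil =>
    cases t <;> simp_all [subtreeAt, lightCount]
  | cons b p ih =>
    cases t with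
    | leaf w => simp [subtreeAt] at h
    | node l r =>
      have hs := ih h
      cases b <;> simp only [lightCount, weight, Bool.false_eq_true, if_true, if_false] at hs ⊢ <;>
        split_ifs with hle <;> simp only [pow_add, pow_one, pow_zero] <;> linarith

/-- if a leaf with label `wℓ` sits at path `p` in a tree of total weight `W`,
then the number of internal nodes on the path from the leaf to the root whose subtree
containing the leaf is no heavier than its sibling subtree is at most `log₂(W / wℓ)`. -/
theorem btree_light_ancestors_le (t : BTree) (p : List Bool) (wl : ℕ+)
    (h : t.subtreeAt p = some (.leaf wl)) :
    (t.lightCount p : ℝ) ≤ Real.logb 2 ((t.weight : ℝ) / (wl : ℝ)) := by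
  have hle : (2 : ℝ) ^ t.lightCount p * (wl : ℝ) ≤ t.weight := by
    exact_mod_cast BTree.two_pow_lightCount_mul_weight_le h
  have hwl : (0 : ℝ) < (wl : ℝ) := by exact_mod_cast wl.pos
  have hpow : (2 : ℝ) ^ t.lightCount p ≤ t.weight / wl := (le_div_iff₀ hwl).2 hle
  rw [Real.le_logb_iff_rpow_le one_lt_two (lt_of_lt_of_le (by positivity) hpow)]
  rwa [Real.rpow_natCast]
end

section
/- Let V be a finite type, G a simple graph on V, and w : V → V → ℝ a symmetric edge-weight function. Let A, B, C ⊆ V be pairwise disjoint nonempty finsets such that no edge of G joins a vertex of A to a vertex of C, and such that the total weight ∑_{(x,y) ∈ E(A,B)} w(x,y) is strictly positive. Then W_avg(A, B ∪ C) < W_avg(A, B). In particular, the unweighted average-linkage (UPGMA) measure is not a triangle-based linkage measure. -/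
open Finset

/-- `E(X, Y)`: the ordered pairs `(x, y)` with `x ∈ X`, `y ∈ Y` and `{x, y}` an edge of `G`. -/
def edgePairs {V : Type*} [DecidableEq V] (G : SimpleGraph V) [DecidableRel G.Adj]
    (X Y : Finset V) : Finset (V × V) :=
  (X ×ˢ Y).filter fun p => G.Adj p.1 p.2

/-- The unweighted average-linkage (UPGMA) similarity between clusters `X` and `Y`. -/
noncomputable def wavg {V : Type*} [DecidableEq V] (G : SimpleGraph V) [DecidableRel G.Adj]
    (w : V → V → ℝ) (X Y : Finset V) : ℝ :=
  (∑ p ∈ edgePairs G X Y, w p.1 p.2) / (X.card * Y.card)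

/-- Enlarging `Y` by vertices not adjacent to `X` adds no edges between `X` and `Y`. -/
theorem edgePairs_union_right_of_not_adj {V : Type*} [DecidableEq V] (G : SimpleGraph V)
    [DecidableRel G.Adj] (X Y Z : Finset V) (h : ∀ x ∈ X, ∀ z ∈ Z, ¬ G.Adj x z) :
    edgePairs G X (Y ∪ Z) = edgePairs G X Y := by
  ext ⟨x, y⟩
  simp only [edgePairs, mem_filter, mem_product, mem_union]
  grind

/-- unweighted average-linkage is not triangle-based.  If `A`, `B`, `C` are
pairwise disjoint nonempty clusters, no edge joins `A` to `C`, and the total weight of the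
edges between `A` and `B` is positive, then `W_avg(A, B ∪ C) < W_avg(A, B)`. -/
theorem average_linkage_not_triangle_based {V : Type*} [Fintype V] [DecidableEq V]
    (G : SimpleGraph V) [DecidableRel G.Adj]
    (w : V → V → ℝ) (hw : ∀ x y, w x y = w y x)
    (A B C : Finset V) (hA : A.Nonempty) (hB : B.Nonempty) (hC : C.Nonempty)
    (hAB : Disjoint A B) (hAC : Disjoint A C) (hBC : Disjoint B C)
    (hnoAC : ∀ a ∈ A, ∀ c ∈ C, ¬ G.Adj a c)
    (hpos : 0 < ∑ p ∈ edgePairs G A B, w p.1 p.2) :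
    wavg G w A (B ∪ C) < wavg G w A B := by
  have hA' : (0 : ℝ) < A.card := by exact_mod_cast hA.card_pos
  have hB' : (0 : ℝ) < B.card := by exact_mod_cast hB.card_pos
  have hC' : (0 : ℝ) < C.card := by exact_mod_cast hC.card_pos
  unfold wavg
  rw [edgePairs_union_right_of_not_adj G A B C hnoAC, card_union_of_disjoint hBC, Nat.cast_add]
  gcongr
  exact lt_add_of_pos_right _ hC'
end
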